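/- For all x, y > 0, ((x-y)/2)² · ζ(2, 1+(x+y)/2) ≤ ln G⋆(x,y). -/

import Mathlib

/-- The second difference of `-log` with midpoint `m` and half-step `d` is at least `(d / m) ^ 2`. -/
lemma sq_mul_one_div_sq_le_two_mul_log_sub {a b : ℝ} (ha : 0 < a) (hb : 0 < b) :
    ((a - b) / 2) ^ 2 * (1 / ((a + b) / 2) ^ 2) ≤
      2 * Real.log ((a + b) / 2) - Real.log a - Real.log b := by
  have hm : 0 < (a + b) / 2 := by positivity
  have h := Real.log_le_sub_one_of_pos (x := a * b / ((a + b) / 2) ^ 2) (by positivity)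
  rw [Real.log_div (by positivity) (by positivity), Real.log_mul ha.ne' hb.ne', Real.log_pow] at h
  have e : ((a - b) / 2) ^ 2 * (1 / ((a + b) / 2) ^ 2) = 1 - a * b / ((a + b) / 2) ^ 2 := by
    field_simp
    ring
  push_cast at h
  linarith

open Real.BohrMollerup in
/-- Comparison of the partial sums of the Hurwitz zeta series at `2` with the midpoint defect of
Euler's approximations to `log Γ`. -/
lemma sum_le_logGammaSeq_add_sub {a b : ℝ} (ha : 0 < a) (hb : 0 < b) (n : ℕ) :
    ∑ k ∈ Finset.range (n + 1), ((a - b) / 2) ^ 2 * (1 / ((k : ℝ) + (a + b) / 2) ^ 2) ≤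
      logGammaSeq a n + logGammaSeq b n - 2 * logGammaSeq ((a + b) / 2) n := by
  have e : logGammaSeq a n + logGammaSeq b n - 2 * logGammaSeq ((a + b) / 2) n =
      ∑ k ∈ Finset.range (n + 1),
        (2 * Real.log ((a + b) / 2 + k) - Real.log (a + k) - Real.log (b + k)) := by
    simp only [logGammaSeq, Finset.sum_sub_distrib, ← Finset.mul_sum]
    ring
  rw [e]
  refine Finset.sum_le_sum fun k _ => ?_
  have h := sq_mul_one_div_sq_le_two_mul_log_sub (a := a + k) (b := b + k)
    (by positivity) (by positivity)
  have e₁ : (a + k + (b + k)) / 2 = (a + b) / 2 + k := by ring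
  have e₂ : a + k - (b + k) = a - b := by ring
  rw [e₁, e₂] at h
  rwa [add_comm (k : ℝ)]

theorem log_gurland_star_lower_bound (x y : ℝ) (hx : 0 < x) (hy : 0 < y) :
    ((x - y) / 2) ^ 2 * (∑' n : ℕ, 1 / ((n : ℝ) + (1 + (x + y) / 2)) ^ 2) ≤
      Real.log (Real.Gamma (1 + x) * Real.Gamma (1 + y) /
        (Real.Gamma (1 + (x + y) / 2)) ^ 2) := by
  have ha : 0 < 1 + x := by positivity
  have hb : 0 < 1 + y := by positivity
  have hm : 0 < 1 + (x + y) / 2 := by positivity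
  have hΓa := (Real.Gamma_pos_of_pos ha).ne'
  have hΓb := (Real.Gamma_pos_of_pos hb).ne'
  have hΓm := (Real.Gamma_pos_of_pos hm).ne'
  rw [Real.log_div (mul_ne_zero hΓa hΓb) (pow_ne_zero 2 hΓm), Real.log_mul hΓa hΓb, Real.log_pow,
    Nat.cast_ofNat, ← tsum_mul_left]
  refine Real.tsum_le_of_sum_range_le (fun n => by positivity) fun n => ?_
  refine ge_of_tendsto (((Real.BohrMollerup.tendsto_log_gamma ha).add
    (Real.BohrMollerup.tendsto_log_gamma hb)).sub
    ((Real.BohrMollerup.tendsto_log_gamma hm).const_mul 2)) ?_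
  filter_upwards [Filter.eventually_ge_atTop n] with N hN
  have h := sum_le_logGammaSeq_add_sub ha hb N
  have e₁ : (1 + x + (1 + y)) / 2 = 1 + (x + y) / 2 := by ring
  have e₂ : 1 + x - (1 + y) = x - y := by ring
  rw [e₁, e₂] at h
  refine le_trans (Finset.sum_le_sum_of_subset_of_nonneg ?_ fun k _ _ => by positivity) h
  exact Finset.range_subset_range.2 (hN.trans N.le_succ)
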